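/- For every integer t ≥ 0, the total domination number of the cubic Knödel graph W_{3,10t+8} equals 4t + 4. -/

import Mathlib

/-- The Knödel graph `W_{Δ,n}` (here `m = n/2`): a bipartite graph on the vertex set
`Bool × ZMod m`, where `(false, i)` plays the role of `u_i` and `(true, j)` the role of `v_j`,
and `u_i` is adjacent to `v_j` iff `j ≡ i + 2^k - 1 (mod m)` for some `0 ≤ k ≤ Δ - 1`. -/
def knodel (Δ m : ℕ) : SimpleGraph (Bool × ZMod m) :=
  SimpleGraph.fromRel (fun a b =>
    a.1 = false ∧ b.1 = true ∧ ∃ k < Δ, b.2 = a.2 + 2 ^ k - 1)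

/-- The total domination number of a graph `G`: the minimum cardinality of a (finite) set `D`
of vertices such that every vertex of `G` has a neighbor in `D`. -/
noncomputable def totalDominationNumber {V : Type*} (G : SimpleGraph V) : ℕ :=
  sInf {k | ∃ D : Set V, D.Finite ∧ D.ncard = k ∧ ∀ v, ∃ d ∈ D, G.Adj v d}

/-- A potential on windows of three consecutive membership values, certifying that covering a
cyclic group by translates of `{0, 1, 3}` requires density at least `2 / 5`. -/
def windowPotential : Bool → Bool → Bool → ℤ
  | false, false, false => -6
  | false, false, true => -4
  | false, true, false => -5
  | false, true, true => -2
  | true, false, false => -3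
  | true, false, true => -2
  | true, true, _ => 0

lemma windowPotential_step (a p q r : Bool) (h : a || p || r) :
    windowPotential a p q + 2 ≤ windowPotential p q r + 5 * (if a then 1 else 0) := by
  revert a p q r
  decide

lemma two_mul_le_five_mul_card {m : ℕ} [NeZero m] (A : Finset (ZMod m))
    (hA : ∀ x, x ∈ A ∨ x - 1 ∈ A ∨ x - 3 ∈ A) : 2 * m ≤ 5 * A.card := by
  let φ : ZMod m → ℤ := fun x =>
    windowPotential (decide (x ∈ A)) (decide (x - 1 ∈ A)) (decide (x - 2 ∈ A))
  have hstep (x : ZMod m) : φ x + 2 ≤ φ (x - 1) + 5 * (if x ∈ A then 1 else 0) := by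
    have h := windowPotential_step (decide (x ∈ A)) (decide (x - 1 ∈ A)) (decide (x - 2 ∈ A))
      (decide (x - 3 ∈ A)) (by simpa [or_assoc] using hA x)
    have h₂ : x - 1 - 1 = x - 2 := by ring
    have h₃ : x - 1 - 2 = x - 3 := by ring
    simpa [φ, h₂, h₃] using h
  have hshift : ∑ x, φ (x - 1) = ∑ x, φ x := (Equiv.subRight (1 : ZMod m)).sum_comp φ
  have hsum := Finset.sum_le_sum fun x (_ : x ∈ Finset.univ) => hstep x
  simp only [Finset.sum_add_distrib, ← Finset.mul_sum, hshift] at hsum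
  simp [ZMod.card] at hsum
  omega

lemma exists_lt_three_eq_add_two_pow_iff {m : ℕ} (i j : ZMod m) :
    (∃ k < 3, j = i + 2 ^ k - 1) ↔ j = i ∨ j = i + 1 ∨ j = i + 3 := by
  have h₀ : i + 2 ^ 0 - 1 = i := by ring
  have h₁ : i + 2 ^ 1 - 1 = i + 1 := by ring
  have h₂ : i + 2 ^ 2 - 1 = i + 3 := by ring
  constructor
  · rintro ⟨k, hk, h⟩
    interval_cases k <;> simp_all only [true_or, or_true]
  · rintro (h | h | h)
    exacts [⟨0, by omega, h.trans h₀.symm⟩, ⟨1, by omega, h.trans h₁.symm⟩,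
      ⟨2, by omega, h.trans h₂.symm⟩]

lemma knodel_three_adj_false {m : ℕ} (i : ZMod m) (d : Bool × ZMod m) :
    (knodel 3 m).Adj (false, i) d ↔
      d.1 = true ∧ (d.2 = i ∨ d.2 = i + 1 ∨ d.2 = i + 3) := by
  obtain ⟨_ | _, j⟩ := d <;> simp [knodel, exists_lt_three_eq_add_two_pow_iff]

lemma knodel_three_adj_true {m : ℕ} (j : ZMod m) (d : Bool × ZMod m) :
    (knodel 3 m).Adj (true, j) d ↔
      d.1 = false ∧ (d.2 = j ∨ d.2 = j - 1 ∨ d.2 = j - 3) := by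
  obtain ⟨_ | _, i⟩ := d
  · simp only [SimpleGraph.adj_comm, knodel_three_adj_false, true_and, eq_sub_iff_add_eq,
      @eq_comm _ j]
  · simp [knodel]

lemma four_mul_le_five_mul_ncard {m : ℕ} [NeZero m] (D : Set (Bool × ZMod m))
    (hD : ∀ v, ∃ d ∈ D, (knodel 3 m).Adj v d) : 4 * m ≤ 5 * D.ncard := by
  classical
  let A : Finset (ZMod m) := {x | (false, x) ∈ D}
  let B : Finset (ZMod m) := {x | (true, -x) ∈ D}
  have hA : 2 * m ≤ 5 * A.card := two_mul_le_five_mul_card A fun x => by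
    obtain ⟨⟨b, i⟩, hd, hadj⟩ := hD (true, x)
    obtain ⟨rfl, rfl | rfl | rfl⟩ := (knodel_three_adj_true _ _).1 hadj <;> simp_all [A]
  have hB : 2 * m ≤ 5 * B.card := two_mul_le_five_mul_card B fun x => by
    obtain ⟨⟨b, j⟩, hd, hadj⟩ := hD (false, -x)
    have h₁ : -x + 1 = 1 - x := by ring
    have h₃ : -x + 3 = 3 - x := by ring
    obtain ⟨rfl, rfl | rfl | rfl⟩ := (knodel_three_adj_false _ _).1 hadj <;> simp_all [B]
  have hcard : A.card + B.card ≤ D.ncard := by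
    let f : ZMod m ⊕ ZMod m → Bool × ZMod m :=
      Sum.elim (fun x => (false, x)) (fun x => (true, -x))
    have hf : f.Injective := by
      rintro (x | x) (y | y) <;> simp [f]
    rw [← Finset.card_disjSum, ← Finset.card_image_of_injective _ hf, ← Set.ncard_coe_finset]
    refine Set.ncard_le_ncard ?_ D.toFinite
    intro d hd
    simp only [Finset.coe_image, Set.mem_image, Finset.mem_coe] at hd
    obtain ⟨x | x, hx, rfl⟩ := hd <;> simpa [f, A, B] using hx
  omega

lemma exists_block_cover (t : ℕ) (x : ZMod (5 * t + 4)) :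
    ∃ s < t + 1, ∃ e < 2, x = ((5 * s + e : ℕ) : ZMod (5 * t + 4)) ∨
      x - 1 = ((5 * s + e : ℕ) : ZMod (5 * t + 4)) ∨
      x - 3 = ((5 * s + e : ℕ) : ZMod (5 * t + 4)) := by
  have hx := x.val_lt
  obtain ⟨n, hn, rfl⟩ : ∃ n < 5 * t + 4, x = (n : ZMod (5 * t + 4)) :=
    ⟨x.val, hx, (ZMod.natCast_zmod_val x).symm⟩
  obtain h | h | h : n % 5 ≤ 1 ∨ n % 5 = 2 ∨ 3 ≤ n % 5 := by omega
  · refine ⟨n / 5, by omega, n % 5, by omega, Or.inl ?_⟩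
    rw [Nat.div_add_mod]
  · refine ⟨n / 5, by omega, 1, by omega, Or.inr (Or.inl ?_)⟩
    rw [sub_eq_iff_eq_add]
    exact_mod_cast congrArg (Nat.cast (R := ZMod (5 * t + 4)))
      (show n = 5 * (n / 5) + 1 + 1 by omega)
  · refine ⟨n / 5, by omega, n % 5 - 3, by omega, Or.inr (Or.inr ?_)⟩
    rw [sub_eq_iff_eq_add]
    exact_mod_cast congrArg (Nat.cast (R := ZMod (5 * t + 4)))
      (show n = 5 * (n / 5) + (n % 5 - 3) + 3 by omega)

lemma exists_dominating_ncard_le (t : ℕ) : ∃ D : Set (Bool × ZMod (5 * t + 4)),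
    D.ncard ≤ 4 * t + 4 ∧ ∀ v, ∃ d ∈ D, (knodel 3 (5 * t + 4)).Adj v d := by
  let f : Bool × ℕ × ℕ → Bool × ZMod (5 * t + 4) := fun p =>
    (p.1, if p.1 then -((5 * p.2.1 + p.2.2 : ℕ) : ZMod (5 * t + 4))
      else ((5 * p.2.1 + p.2.2 : ℕ) : ZMod (5 * t + 4)))
  let S : Finset (Bool × ℕ × ℕ) := Finset.univ ×ˢ Finset.range (t + 1) ×ˢ Finset.range 2
  refine ⟨(S.image f : Finset _), ?_, ?_⟩
  · rw [Set.ncard_coe_finset]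
    refine Finset.card_image_le.trans ?_
    simp only [S, Finset.card_product, Finset.card_range, Finset.card_univ, Fintype.card_bool]
    omega
  · rintro ⟨_ | _, x⟩
    · obtain ⟨s, hs, e, he, h⟩ := exists_block_cover t (-x)
      refine ⟨f (true, s, e), ?_, ?_⟩
      · exact Finset.mem_coe.2 (Finset.mem_image_of_mem f (by simp [S, hs, he]))
      · rw [knodel_three_adj_false]
        refine ⟨rfl, ?_⟩
        simp only [f, if_true]
        grind
    · obtain ⟨s, hs, e, he, h⟩ := exists_block_cover t x
      refine ⟨f (false, s, e), ?_, ?_⟩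
      · exact Finset.mem_coe.2 (Finset.mem_image_of_mem f (by simp [S, hs, he]))
      · rw [knodel_three_adj_true]
        refine ⟨rfl, ?_⟩
        simpa [f, eq_comm] using h

/-- Case 5: for every `t ≥ 0`, the total domination number of `W_{3,10t+8}` equals `4t + 4`. -/
theorem knodel_stmt_17 (t : ℕ) :
    totalDominationNumber (knodel 3 ((10 * t + 8) / 2)) = 4 * t + 4 := by
  rw [show (10 * t + 8) / 2 = 5 * t + 4 by omega]
  refine IsLeast.csInf_eq ⟨?_, ?_⟩
  · obtain ⟨D, hcard, hD⟩ := exists_dominating_ncard_le t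
    have := four_mul_le_five_mul_ncard D hD
    exact ⟨D, D.toFinite, by omega, hD⟩
  · rintro k ⟨D, -, rfl, hD⟩
    have := four_mul_le_five_mul_ncard D hD
    omega
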